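/- Assume Hypothesis (U2). Then there exists a constant K ≥ 1 (depending only on the constant C from (U2)) such that the following holds. Let A be a set of squares, let Q ⊆ ℤ be a finite set, and let L ⊆ ℤ × ℤ be a finite set of pairs (b, d) such that every first coordinate b is a nonzero perfect square. Then the number of triples (a, c, (b, d)) ∈ A × Q × L with a = b·c + d is at most K·(τ(L)^{1/4}·|Q|·|L|^{3/4} + |L|). -/

import Mathlib

open Finset

/-- Hypothesis (U2): an instance of the Uniformity Conjecture. -/
def U2 (C : ℕ) : Prop :=
  ∀ α β γ : ℤ, α ≠ 0 → β ≠ 0 → γ ≠ 0 → α ≠ β → α ≠ γ → β ≠ γ →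
    {p : ℚ × ℚ |
        p.2 ^ 2 = (p.1 ^ 2 + (α : ℚ)) * (p.1 ^ 2 + (β : ℚ)) * (p.1 ^ 2 + (γ : ℚ))}.Finite ∧
    {p : ℚ × ℚ |
        p.2 ^ 2 = (p.1 ^ 2 + (α : ℚ)) * (p.1 ^ 2 + (β : ℚ)) * (p.1 ^ 2 + (γ : ℚ))}.ncard ≤ C

/-- `τ(L)`: the maximal number of points of `L` on a line `y = λ·x` through the origin
(with `x ≠ 0`). -/
def tau (L : Finset (ℤ × ℤ)) : ℕ :=
  (L.image fun p => (p.2 : ℚ) / (p.1 : ℚ)).sup fun lam =>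
    (L.filter fun p => p.1 ≠ 0 ∧ (p.2 : ℚ) = lam * (p.1 : ℚ)).card

/-- The elements of `L` with a given ratio `p.2 / p.1` number at most `tau L`. -/
theorem card_filter_ratio_le_tau (L : Finset (ℤ × ℤ)) (hL : ∀ p ∈ L, p.1 ≠ 0) (lam : ℚ)
    (hlam : lam ∈ L.image fun p => (p.2 : ℚ) / (p.1 : ℚ)) :
    (L.filter fun p => (p.2 : ℚ) / (p.1 : ℚ) = lam).card ≤ tau L := by
  unfold tau
  refine le_trans ?_ (le_sup hlam)
  refine card_le_card fun p hp => ?_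
  rw [mem_filter] at hp ⊢
  have h0 : (p.1 : ℚ) ≠ 0 := Int.cast_ne_zero.mpr (hL p hp.1)
  exact ⟨hp.1, hL p hp.1, (div_eq_iff h0).mp hp.2⟩

/-- Under `U2`, at most `C` rationals make four given distinct integers squares by translation. -/
theorem card_le_of_isSquare_add {C : ℕ} (hU2 : U2 C) {T : Finset ℤ} (hT : T.card = 4)
    {S : Finset ℚ} (hS : ∀ lam ∈ S, ∀ c ∈ T, ∃ x : ℚ, x ^ 2 = lam + c) : S.card ≤ C := by
  obtain ⟨c, c₁, c₂, c₃, h01, h02, h03, h12, h13, h23, rfl⟩ := card_eq_four.mp hT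
  obtain ⟨hfin, hcard⟩ := hU2 (c₁ - c) (c₂ - c) (c₃ - c) (sub_ne_zero.mpr h01.symm)
    (sub_ne_zero.mpr h02.symm) (sub_ne_zero.mpr h03.symm) (by simpa using h12)
    (by simpa using h13) (by simpa using h23)
  rw [Set.ncard_eq_toFinset_card _ hfin] at hcard
  have hsub : S ⊆ hfin.toFinset.image fun p => p.1 ^ 2 - (c : ℚ) := fun lam hlam => by
    obtain ⟨x, hx⟩ := hS lam hlam c (by simp)
    obtain ⟨x₁, hx₁⟩ := hS lam hlam c₁ (by simp)
    obtain ⟨x₂, hx₂⟩ := hS lam hlam c₂ (by simp)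
    obtain ⟨x₃, hx₃⟩ := hS lam hlam c₃ (by simp)
    refine mem_image.mpr ⟨(x, x₁ * x₂ * x₃), ?_, by simp [hx]⟩
    rw [Set.Finite.mem_toFinset, Set.mem_ofPred_eq]
    push_cast
    rw [mul_pow, mul_pow, hx, hx₁, hx₂, hx₃]
    ring
  exact (card_le_card hsub).trans (card_image_le.trans hcard)

/-- Under `U2`, any four distinct points of `Q` are jointly incident to at most `tau L * C`
elements of `L`. -/
theorem card_filter_subset_le {C : ℕ} (hU2 : U2 C) {A : Finset ℤ}
    (hA : ∀ a ∈ A, ∃ m : ℤ, a = m ^ 2) {L : Finset (ℤ × ℤ)}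
    (hL : ∀ p ∈ L, p.1 ≠ 0 ∧ ∃ m : ℤ, p.1 = m ^ 2) (Q : Finset ℤ)
    {T : Finset ℤ} (hT : T.card = 4) :
    (L.filter fun p => T ⊆ Q.filter fun c => p.1 * c + p.2 ∈ A).card ≤ tau L * C := by
  set M := L.filter fun p => T ⊆ Q.filter fun c => p.1 * c + p.2 ∈ A
  have hML : M ⊆ L := filter_subset _ _
  have hfib : ∀ lam ∈ M.image (fun p => (p.2 : ℚ) / (p.1 : ℚ)),
      (M.filter fun p => (p.2 : ℚ) / (p.1 : ℚ) = lam).card ≤ tau L := fun lam hlam =>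
    (card_le_card (filter_subset_filter _ hML)).trans
      (card_filter_ratio_le_tau L (fun p hp => (hL p hp).1) lam (image_subset_image hML hlam))
  refine (card_le_mul_card_image M _ hfib).trans (Nat.mul_le_mul_left _ ?_)
  refine card_le_of_isSquare_add hU2 hT fun lam hlam c hc => ?_
  obtain ⟨p, hp, rfl⟩ := mem_image.mp hlam
  obtain ⟨hpL, hTp⟩ := mem_filter.mp hp
  obtain ⟨n, hn⟩ := hA _ (mem_filter.mp (hTp hc)).2
  obtain ⟨h0, m, hm⟩ := hL p hpL
  have hm0 : (m : ℚ) ≠ 0 := by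
    intro h
    exact h0 (by simp [hm, Int.cast_eq_zero.mp h])
  refine ⟨n / m, ?_⟩
  have hn' : (p.1 : ℚ) * c + p.2 = n ^ 2 := mod_cast hn
  have hm' : (p.1 : ℚ) = m ^ 2 := mod_cast hm
  rw [hm'] at hn' ⊢
  rw [div_pow, ← hn']
  field_simp
  ring

/-- Double counting of fourfold incidences. -/
theorem sum_card_sub_three_pow_le {ι : Type*} (L : Finset ι) (Q : Finset ℤ)
    (S : ι → Finset ℤ) (hS : ∀ p ∈ L, S p ⊆ Q) (B : ℕ)
    (hB : ∀ T : Finset ℤ, T.card = 4 → (L.filter fun p => T ⊆ S p).card ≤ B) :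
    ∑ p ∈ L, ((S p).card - 3) ^ 4 ≤ B * Q.card ^ 4 := by
  have hcount : ∑ p ∈ L, (S p).card.choose 4 ≤ Q.card.choose 4 * B := by
    have hdouble := sum_card_bipartiteAbove_eq_sum_card_bipartiteBelow
      (s := L) (t := powersetCard 4 Q) fun p T => T ⊆ S p
    calc ∑ p ∈ L, (S p).card.choose 4
        ≤ ∑ p ∈ L, (bipartiteAbove (fun p T => T ⊆ S p) (powersetCard 4 Q) p).card := by
          refine sum_le_sum fun p hp => ?_
          rw [← card_powersetCard]
          refine card_le_card fun T hT => ?_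
          rw [mem_powersetCard] at hT
          exact mem_filter.mpr ⟨mem_powersetCard.mpr ⟨hT.1.trans (hS p hp), hT.2⟩, hT.1⟩
      _ = ∑ T ∈ powersetCard 4 Q, (bipartiteBelow (fun p T => T ⊆ S p) L T).card := hdouble
      _ ≤ (powersetCard 4 Q).card • B :=
          sum_le_card_nsmul _ _ _ fun T hT => hB T (mem_powersetCard.mp hT).2
      _ = Q.card.choose 4 * B := by rw [card_powersetCard, smul_eq_mul]
  calc ∑ p ∈ L, ((S p).card - 3) ^ 4
      ≤ ∑ p ∈ L, Nat.factorial 4 * (S p).card.choose 4 := by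
        refine sum_le_sum fun p _ => ?_
        rw [← Nat.descFactorial_eq_factorial_mul_choose]
        simpa using Nat.pow_sub_le_descFactorial (S p).card 4
    _ ≤ Nat.factorial 4 * (Q.card.choose 4 * B) := by
        rw [← mul_sum]
        exact Nat.mul_le_mul_left _ hcount
    _ = B * Q.card.descFactorial 4 := by
        rw [Nat.descFactorial_eq_factorial_mul_choose]
        ring
    _ ≤ B * Q.card ^ 4 := Nat.mul_le_mul_left _ (Nat.descFactorial_le_pow _ _)

/-- The incidences are counted by summing, over `L`, the incident points of `Q`. -/
theorem card_incidences_le (A Q : Finset ℤ) (L : Finset (ℤ × ℤ)) :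
    ((A ×ˢ Q ×ˢ L).filter (fun t => t.1 = t.2.2.1 * t.2.1 + t.2.2.2)).card ≤
      ∑ p ∈ L, (Q.filter fun c => p.1 * c + p.2 ∈ A).card := by
  rw [← card_sigma]
  refine card_le_card_of_injOn (fun t => ⟨t.2.2, t.2.1⟩) ?_ ?_
  · rintro ⟨a, c, p⟩ h
    simp only [coe_filter, mem_product, Set.mem_ofPred_eq] at h
    simp only [coe_sigma, Set.mem_sigma_iff, mem_coe, mem_filter]
    exact ⟨h.1.2.2, h.1.2.1, h.2 ▸ h.1.1⟩
  · rintro ⟨a, c, p⟩ h ⟨a', c', p'⟩ h' heq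
    simp only [coe_filter, mem_product, Set.mem_ofPred_eq] at h h'
    simp only [Sigma.mk.injEq, heq_eq_eq] at heq
    obtain ⟨rfl, rfl⟩ := heq
    rw [h.2, h'.2]

/-- incidence bound for squares, when the first coordinates of `L` are nonzero
squares: the number of solutions to `a = b·c + d` with `a ∈ A`, `c ∈ Q`, `(b, d) ∈ L` is
`O(τ(L)^{1/4}·|Q|·|L|^{3/4} + |L|)`. -/
theorem squares_incidences_square_slopes (C : ℕ) (hC : 1 ≤ C) (hU2 : U2 C) :
    ∃ K : ℝ, 1 ≤ K ∧
      ∀ (A : Finset ℤ), (∀ a ∈ A, ∃ m : ℤ, a = m ^ 2) →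
      ∀ (Q : Finset ℤ) (L : Finset (ℤ × ℤ)),
        (∀ p ∈ L, p.1 ≠ 0 ∧ ∃ m : ℤ, p.1 = m ^ 2) →
        ((((A ×ˢ Q ×ˢ L).filter
            (fun t => t.1 = t.2.2.1 * t.2.1 + t.2.2.2)).card : ℝ)) ≤
          K * ((tau L : ℝ) ^ ((1 : ℝ) / 4) * (Q.card : ℝ) * (L.card : ℝ) ^ ((3 : ℝ) / 4) +
                (L.card : ℝ)) := by
  have hC' : (1 : ℝ) ≤ C := mod_cast hC
  refine ⟨C + 3, by linarith, fun A hA Q L hL => ?_⟩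
  set r : ℤ × ℤ → Finset ℤ := fun p => Q.filter fun c => p.1 * c + p.2 ∈ A
  have hfour : ∑ p ∈ L, ((r p).card - 3) ^ 4 ≤ tau L * C * Q.card ^ 4 :=
    sum_card_sub_three_pow_le L Q r (fun p _ => filter_subset _ _) _
      fun T hT => card_filter_subset_le hU2 hA hL Q hT
  have hpow : ((∑ p ∈ L, ((r p).card - 3) : ℕ) : ℝ) ^ 4 ≤
      (L.card : ℝ) ^ 3 * (tau L * C * (Q.card : ℝ) ^ 4) := by
    have hjensen : ((∑ p ∈ L, ((r p).card - 3) : ℕ) : ℝ) ^ 4 ≤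
        (L.card : ℝ) ^ 3 * ((∑ p ∈ L, ((r p).card - 3) ^ 4 : ℕ) : ℝ) := by
      exact_mod_cast pow_sum_le_card_mul_sum_pow (s := L)
        (f := fun p => (r p).card - 3) (fun _ _ => Nat.zero_le _) 3
    refine hjensen.trans (mul_le_mul_of_nonneg_left ?_ (by positivity))
    exact_mod_cast hfour
  have hsum : ∑ p ∈ L, (r p).card ≤ ∑ p ∈ L, ((r p).card - 3) + 3 * L.card := by
    rw [mul_comm, ← smul_eq_mul, ← sum_const, ← sum_add_distrib]
    exact sum_le_sum fun p _ => by omega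
  have hroot : ((∑ p ∈ L, ((r p).card - 3) : ℕ) : ℝ) ≤
      C * ((tau L : ℝ) ^ ((1 : ℝ) / 4) * (Q.card : ℝ) * (L.card : ℝ) ^ ((3 : ℝ) / 4)) := by
    refine le_of_pow_le_pow_left₀ (n := 4) (by norm_num) (by positivity) ?_
    have hτ : ((tau L : ℝ) ^ ((1 : ℝ) / 4)) ^ 4 = tau L := by
      rw [← Real.rpow_mul_natCast (by positivity)]
      norm_num
    have hcard : ((L.card : ℝ) ^ ((3 : ℝ) / 4)) ^ 4 = (L.card : ℝ) ^ 3 := by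
      rw [← Real.rpow_mul_natCast (by positivity)]
      norm_num
    rw [mul_pow, mul_pow, mul_pow, hτ, hcard]
    calc ((∑ p ∈ L, ((r p).card - 3) : ℕ) : ℝ) ^ 4
        ≤ (L.card : ℝ) ^ 3 * (tau L * C * (Q.card : ℝ) ^ 4) := hpow
      _ = C * (tau L * (Q.card : ℝ) ^ 4 * (L.card : ℝ) ^ 3) := by ring
      _ ≤ (C : ℝ) ^ 4 * (tau L * (Q.card : ℝ) ^ 4 * (L.card : ℝ) ^ 3) := by
          gcongr
          exact le_self_pow₀ hC' (by norm_num)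
  have htotal : ((((A ×ˢ Q ×ˢ L).filter
      (fun t => t.1 = t.2.2.1 * t.2.1 + t.2.2.2)).card : ℝ)) ≤
      ((∑ p ∈ L, ((r p).card - 3) : ℕ) : ℝ) + 3 * L.card :=
    mod_cast (card_incidences_le A Q L).trans hsum
  have hmain : (0 : ℝ) ≤
      (tau L : ℝ) ^ ((1 : ℝ) / 4) * (Q.card : ℝ) * (L.card : ℝ) ^ ((3 : ℝ) / 4) := by positivity
  have hcardC : (0 : ℝ) ≤ C * L.card := by positivity
  linarith
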